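/- arXiv:1909.06739 — 5 statements merged into one kernel-verified Lean document; each statement's English description precedes it below -/
import Mathlib

section
/- Let T>0, γ≥1, and let N≥2 be an integer. With τ=T^{1/γ}/N and t_i=(iτ)^γ for 0≤i≤N, set τ_n=t_n−t_{n−1}. Then for every n with 2≤n≤N one has t_n ≤ 2^γ t_{n−1} and γ·τ·t_{n−1}^{1−1/γ} ≤ τ_n ≤ γ·τ·t_n^{1−1/γ}. -/
/-- Graded time mesh `t_i = (i τ)^γ` with `τ = T^(1/γ)/N`. -/
noncomputable def tmesh (T γ : ℝ) (N : ℕ) (i : ℕ) : ℝ :=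
  ((i : ℝ) * (T ^ (1/γ) / (N : ℝ))) ^ γ

/-- Mesh step `τ_n = t_n - t_{n-1}`. -/
noncomputable def tstep (T γ : ℝ) (N n : ℕ) : ℝ :=
  tmesh T γ N n - tmesh T γ N (n - 1)

/-- The graph of `x ↦ x ^ p` with `1 ≤ p` lies above its tangent lines at positive points. -/
lemma mul_rpow_sub_one_mul_sub_le_rpow_sub_rpow {p x y : ℝ} (hp : 1 ≤ p) (hx : 0 < x)
    (hy : 0 ≤ y) : p * x ^ (p - 1) * (y - x) ≤ y ^ p - x ^ p := by
  have hd : HasDerivAt (fun z : ℝ ↦ z ^ p) (p * x ^ (p - 1)) x :=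
    Real.hasDerivAt_rpow_const (Or.inl hx.ne')
  have hc := convexOn_rpow hp
  rcases lt_trichotomy x y with h | rfl | h
  · have := hc.le_slope_of_hasDerivAt hx.le hy h hd
    rwa [slope_def_field, le_div_iff₀ (sub_pos.2 h)] at this
  · simp
  · have := hc.slope_le_of_hasDerivAt hy hx.le h hd
    rw [slope_def_field, div_le_iff₀ (sub_pos.2 h)] at this
    linarith

/-- The exponent `1 - 1 / p` turns a `p`-th power into a `(p - 1)`-th power. -/
lemma rpow_rpow_one_sub_one_div {p x : ℝ} (hp : p ≠ 0) (hx : 0 ≤ x) :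
    (x ^ p) ^ (1 - 1 / p) = x ^ (p - 1) := by
  rw [← Real.rpow_mul hx, mul_sub, mul_one, mul_one_div_cancel hp]

theorem stmt0 (T γ : ℝ) (hT : 0 < T) (hγ : 1 ≤ γ) (N : ℕ) (hN : 2 ≤ N)
    (n : ℕ) (hn2 : 2 ≤ n) (hnN : n ≤ N) :
    tmesh T γ N n ≤ 2 ^ γ * tmesh T γ N (n - 1) ∧
    γ * (T ^ (1/γ) / (N : ℝ)) * (tmesh T γ N (n - 1)) ^ (1 - 1/γ) ≤ tstep T γ N n ∧
    tstep T γ N n ≤ γ * (T ^ (1/γ) / (N : ℝ)) * (tmesh T γ N n) ^ (1 - 1/γ) := by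
  have hγ0 : γ ≠ 0 := by positivity
  have hN0 : (0 : ℝ) < N := by exact_mod_cast (by omega : 0 < N)
  obtain ⟨m, rfl⟩ : ∃ m, n = m + 1 := ⟨n - 1, by omega⟩
  have hm : (1 : ℝ) ≤ m := by exact_mod_cast (by omega : 1 ≤ m)
  simp only [tstep, tmesh, Nat.add_sub_cancel, Nat.cast_add, Nat.cast_one]
  have hτ : 0 < T ^ (1 / γ) / (N : ℝ) := by positivity
  generalize T ^ (1 / γ) / (N : ℝ) = τ at hτ ⊢
  have hx : 0 < (m : ℝ) * τ := by positivity
  have hy : 0 < ((m : ℝ) + 1) * τ := by positivity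
  rw [rpow_rpow_one_sub_one_div hγ0 hx.le, rpow_rpow_one_sub_one_div hγ0 hy.le]
  refine ⟨?_, ?_, ?_⟩
  · rw [← Real.mul_rpow zero_le_two hx.le]
    exact Real.rpow_le_rpow hy.le (by nlinarith) (by linarith)
  · have := mul_rpow_sub_one_mul_sub_le_rpow_sub_rpow hγ hx hy.le
    linarith
  · have := mul_rpow_sub_one_mul_sub_le_rpow_sub_rpow hγ hy hx.le
    linarith
end

section
/- Let T>0, γ≥1, N≥2, and 0<α<1. With the graded mesh t_i=(iτ)^γ, τ=T^{1/γ}/N, τ_n=t_n−t_{n−1}, and L^{i,j}=(1/2)∫_{t_{i−1}}^{t_i}(s−t_{i−1})(t_i−s)ω_α(t_j−s)ds, one has for all 2≤i≤j≤N: L^{i−1,j−1} ≥ (τ_{i−1}³/τ_i³)·L^{i,j}. -/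
/-- Kernel `ω_β(t) = t^(β-1)/Γ(β)`. -/
noncomputable def omegaK (β t : ℝ) : ℝ := t ^ (β - 1) / Real.Gamma β

/-- `L^{i,j} = (1/2)∫_{t_{i-1}}^{t_i} (s-t_{i-1})(t_i-s) ω_α(t_j-s) ds`. -/
noncomputable def Lmat (T γ α : ℝ) (N : ℕ) (i j : ℕ) : ℝ :=
  (1/2) * ∫ s in tmesh T γ N (i - 1)..tmesh T γ N i,
    (s - tmesh T γ N (i - 1)) * (tmesh T γ N i - s) * omegaK α (tmesh T γ N j - s)

open intervalIntegral in
/-- A mesh integral against the quadratic bubble, rescaled to the unit interval. -/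
theorem integral_bubble_mul (a b : ℝ) (f : ℝ → ℝ) :
    ∫ s in a..b, (s - a) * (b - s) * f s =
      (b - a) ^ 3 * ∫ x in (0 : ℝ)..1, x * (1 - x) * f ((b - a) * x + a) := by
  have h := mul_integral_comp_mul_add (a := 0) (b := 1)
    (f := fun s => (s - a) * (b - s) * f s) (b - a) a
  rw [mul_zero, zero_add, mul_one, sub_add_cancel] at h
  rw [← h, ← integral_const_mul, ← integral_const_mul]
  refine integral_congr fun x _ => ?_
  ring

theorem intervalIntegrable_bubble_mul_omegaK {α : ℝ} (hα : 0 < α) {c : ℝ} (hc : c ≠ 0) (d : ℝ) :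
    IntervalIntegrable (fun x => x * (1 - x) * omegaK α (d - c * x)) MeasureTheory.volume 0 1 := by
  have h : IntervalIntegrable (fun x : ℝ => x ^ (α - 1)) MeasureTheory.volume d (d - c) :=
    intervalIntegral.intervalIntegrable_rpow' (by linarith)
  have h₁ := (h.comp_sub_left d).comp_mul_left (c := c)
  have h₂ : IntervalIntegrable (fun x : ℝ => (d - c * x) ^ (α - 1)) MeasureTheory.volume 0 1 := by
    simpa [hc] using h₁
  exact (h₂.div_const (Real.Gamma α)).continuousOn_mul (by fun_prop)

theorem omegaK_le_omegaK {α : ℝ} (hα0 : 0 < α) (hα1 : α < 1) {x y : ℝ} (hx : 0 < x) (hxy : x ≤ y) :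
    omegaK α y ≤ omegaK α x :=
  div_le_div_of_nonneg_right (Real.rpow_le_rpow_of_nonpos hx hxy (by linarith))
    (Real.Gamma_pos_of_pos hα0).le

theorem tmesh_strictMono {T γ : ℝ} {N : ℕ} (hT : 0 < T) (hγ : 0 < γ) (hN : 0 < N) :
    StrictMono (tmesh T γ N) := by
  intro a b hab
  have hc : 0 < T ^ (1 / γ) / (N : ℝ) := by positivity
  exact Real.rpow_lt_rpow (by positivity)
    (mul_lt_mul_of_pos_right (Nat.cast_lt.mpr hab) hc) hγ

theorem tmesh_sub_monotone {T γ : ℝ} (hT : 0 < T) (hγ : 1 ≤ γ) (N : ℕ) :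
    Monotone fun n => tmesh T γ N (n + 1) - tmesh T γ N n := by
  refine monotone_nat_of_le_succ fun n => ?_
  have hc : 0 ≤ T ^ (1 / γ) / (N : ℝ) := by positivity
  have h := (convexOn_rpow hγ).2
    (show (n : ℝ) * (T ^ (1 / γ) / (N : ℝ)) ∈ Set.Ici 0 from mul_nonneg n.cast_nonneg hc)
    (show ((n + 2 : ℕ) : ℝ) * (T ^ (1 / γ) / (N : ℝ)) ∈ Set.Ici 0 from
      mul_nonneg (Nat.cast_nonneg _) hc)
    (show (0 : ℝ) ≤ 1 / 2 by norm_num) (show (0 : ℝ) ≤ 1 / 2 by norm_num) (by norm_num)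
  have hmid : (1 / 2 : ℝ) • ((n : ℝ) * (T ^ (1 / γ) / (N : ℝ))) +
      (1 / 2 : ℝ) • (((n + 2 : ℕ) : ℝ) * (T ^ (1 / γ) / (N : ℝ))) =
      ((n + 1 : ℕ) : ℝ) * (T ^ (1 / γ) / (N : ℝ)) := by
    simp only [smul_eq_mul]
    push_cast
    ring
  rw [hmid] at h
  change tmesh T γ N (n + 1) ≤ 1 / 2 * tmesh T γ N n + 1 / 2 * tmesh T γ N (n + 2) at h
  linarith

theorem Lmat_eq (T γ α : ℝ) (N i j : ℕ) :
    Lmat T γ α N i j = tstep T γ N i ^ 3 * ((1 / 2) * ∫ x in (0 : ℝ)..1, x * (1 - x) *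
      omegaK α (tmesh T γ N j - tmesh T γ N (i - 1) - tstep T γ N i * x)) := by
  rw [Lmat, integral_bubble_mul _ _ fun s => omegaK α (tmesh T γ N j - s), mul_left_comm]
  simp only [tstep, sub_sub, add_comm]

theorem stmt2 (T γ α : ℝ) (hT : 0 < T) (hγ : 1 ≤ γ) (hα0 : 0 < α) (hα1 : α < 1)
    (N : ℕ) (hN : 2 ≤ N) (i j : ℕ) (hi : 2 ≤ i) (hij : i ≤ j) (hjN : j ≤ N) :
    (tstep T γ N (i - 1)) ^ 3 / (tstep T γ N i) ^ 3 * Lmat T γ α N i j ≤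
      Lmat T γ α N (i - 1) (j - 1) := by
  obtain ⟨k, rfl⟩ := Nat.exists_eq_add_of_le' hi
  obtain ⟨l, rfl⟩ := Nat.exists_eq_add_of_le' (hi.trans hij)
  have hmono := tmesh_strictMono (γ := γ) hT (by linarith) (show 0 < N by lia)
  have hpos : ∀ n, 0 < tstep T γ N (n + 1) := fun n => sub_pos.mpr (hmono (Nat.lt_succ_self n))
  have hstep := tmesh_sub_monotone hT hγ N
  have hk : tstep T γ N (k + 1) ≤ tstep T γ N (k + 2) := hstep (Nat.le_succ k)
  have hl : tstep T γ N (k + 2) ≤ tstep T γ N (l + 2) := hstep (show k + 1 ≤ l + 1 by lia)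
  have hkl : tmesh T γ N (k + 1) ≤ tmesh T γ N (l + 1) := hmono.monotone (by lia)
  have hk' := hpos k
  have e₁ : tstep T γ N (k + 1) = tmesh T γ N (k + 1) - tmesh T γ N k := rfl
  have e₂ : tstep T γ N (l + 2) = tmesh T γ N (l + 2) - tmesh T γ N (l + 1) := rfl
  rw [Lmat_eq, Lmat_eq, ← mul_assoc, div_mul_cancel₀ _ (pow_pos (hpos (k + 1)) 3).ne']
  simp only [Nat.add_succ_sub_one, add_zero]
  refine mul_le_mul_of_nonneg_left (mul_le_mul_of_nonneg_left ?_ (by norm_num))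
    (pow_pos hk' 3).le
  refine intervalIntegral.integral_mono_on zero_le_one
    (intervalIntegrable_bubble_mul_omegaK hα0 (hpos (k + 1)).ne' _)
    (intervalIntegrable_bubble_mul_omegaK hα0 hk'.ne' _) fun x hx => ?_
  obtain rfl | hx1 := hx.2.eq_or_lt
  · simp
  refine mul_le_mul_of_nonneg_left (omegaK_le_omegaK hα0 hα1 ?_ ?_)
    (mul_nonneg hx.1 (by linarith))
  · nlinarith [mul_pos hk' (sub_pos.mpr hx1)]
  · nlinarith [mul_le_mul_of_nonneg_right hk (sub_nonneg.mpr hx.2)]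
end

section
/- Let X be a real Banach space, let 0<a<b, and let u:[a,b]→X be three times continuously differentiable. Set τ=b−a, ∂u=(u(b)−u(a))/τ and m=(a+b)/2. Then for every s∈[a,b]: u′(s) − ∂u = e₁(s) + e₂(s), where e₁(s)=∫_s^b (q−s)·u‴(q)dq − (1/(2τ))·∫_a^b (q−a)²·u‴(q)dq and e₂(s)=(s−m)·u″(b). -/
/-- Fundamental theorem of calculus for a function with a continuous derivative within `[a, b]`,
on a final subinterval `[s, b]`. -/
theorem integral_eq_sub_of_hasDerivWithinAt_Icc {X : Type*} [NormedAddCommGroup X]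
    [NormedSpace ℝ X] [CompleteSpace X] {a b s : ℝ} {F f : ℝ → X} (hs : s ∈ Set.Icc a b)
    (hF : ∀ q ∈ Set.Icc a b, HasDerivWithinAt F (f q) (Set.Icc a b) q)
    (hf : ContinuousOn f (Set.Icc a b)) :
    ∫ q in s..b, f q = F b - F s := by
  have hsub : Set.Icc s b ⊆ Set.Icc a b := Set.Icc_subset_Icc_left hs.1
  refine intervalIntegral.integral_eq_sub_of_hasDerivAt_of_le hs.2
    (fun q hq => (hF q (hsub hq)).continuousWithinAt.mono hsub)
    (fun q hq => (hF q (hsub (Set.Ioo_subset_Icc_self hq))).hasDerivAt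
      (Icc_mem_nhds (hs.1.trans_lt hq.1) hq.2))
    ((hf.mono hsub).intervalIntegrable_of_Icc hs.2)


theorem stmt7 {X : Type*} [NormedAddCommGroup X] [NormedSpace ℝ X] [CompleteSpace X]
    (a b : ℝ) (ha : 0 < a) (hab : a < b)
    (u u' u'' u''' : ℝ → X)
    (hu : ∀ s ∈ Set.Icc a b, HasDerivWithinAt u (u' s) (Set.Icc a b) s)
    (hu' : ∀ s ∈ Set.Icc a b, HasDerivWithinAt u' (u'' s) (Set.Icc a b) s)
    (hu'' : ∀ s ∈ Set.Icc a b, HasDerivWithinAt u'' (u''' s) (Set.Icc a b) s)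
    (hcont : ContinuousOn u''' (Set.Icc a b)) :
    ∀ s ∈ Set.Icc a b,
      u' s - (b - a)⁻¹ • (u b - u a) =
        ((∫ q in s..b, (q - s) • u''' q)
          - (2 * (b - a))⁻¹ • ∫ q in a..b, ((q - a) ^ 2) • u''' q)
        + (s - (a + b) / 2) • u'' b := by
  intro s hs
  have h₁ : ∫ q in s..b, (q - s) • u''' q = ((b - s) • u'' b - u' b) - ((s - s) • u'' s - u' s) := by
    refine integral_eq_sub_of_hasDerivWithinAt_Icc (F := fun q => (q - s) • u'' q - u' q) hs
      (fun q hq => ?_) (by fun_prop)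
    have hd : HasDerivWithinAt (fun q : ℝ => q - s) 1 (Set.Icc a b) q :=
      (hasDerivWithinAt_id q _).sub_const s
    refine ((hd.smul (hu'' q hq)).sub (hu' q hq)).congr_deriv ?_
    module
  have h₂ : ∫ q in a..b, ((q - a) ^ 2) • u''' q =
      ((b - a) ^ 2 • u'' b - (2 * (b - a)) • u' b + (2 : ℝ) • u b) -
        ((a - a) ^ 2 • u'' a - (2 * (a - a)) • u' a + (2 : ℝ) • u a) := by
    refine integral_eq_sub_of_hasDerivWithinAt_Icc
      (F := fun q => (q - a) ^ 2 • u'' q - (2 * (q - a)) • u' q + (2 : ℝ) • u q)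
      (Set.left_mem_Icc.2 hab.le) (fun q hq => ?_) (by fun_prop)
    have hd : HasDerivWithinAt (fun q : ℝ => q - a) 1 (Set.Icc a b) q :=
      (hasDerivWithinAt_id q _).sub_const a
    refine ((((hd.pow 2).smul (hu'' q hq)).sub ((hd.const_mul 2).smul (hu' q hq))).add
      ((hu q hq).const_smul (2 : ℝ))).congr_deriv ?_
    simp only [Pi.pow_apply]
    push_cast
    module
  have hne : b - a ≠ 0 := sub_ne_zero.2 hab.ne'
  rw [h₁, h₂]
  match_scalars <;> field_simp <;> ring
end

section
/- Let T>0, γ≥1 and let N≥2 be an integer. With the graded mesh t_i=(iτ)^γ, τ=T^{1/γ}/N, one has for every j with 2≤j≤N and every s with 0≤s≤t₁: t_{j−1} − s ≥ (j/2)^γ·(t₁ − s). -/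
/-- Every graded mesh point is a power multiple of the first one. -/
theorem tmesh_eq_rpow_mul_tmesh_one {T : ℝ} (hT : 0 ≤ T) (γ : ℝ) (N i : ℕ) :
    tmesh T γ N i = (i : ℝ) ^ γ * tmesh T γ N 1 := by
  unfold tmesh
  rw [Real.mul_rpow i.cast_nonneg (by positivity), Nat.cast_one, one_mul]

theorem stmt8 (T γ : ℝ) (hT : 0 < T) (hγ : 1 ≤ γ) (N : ℕ) (hN : 2 ≤ N)
    (j : ℕ) (hj : 2 ≤ j) (hjN : j ≤ N)
    (s : ℝ) (hs0 : 0 ≤ s) (hs1 : s ≤ tmesh T γ N 1) :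
    ((j : ℝ) / 2) ^ γ * (tmesh T γ N 1 - s) ≤ tmesh T γ N (j - 1) - s := by
  have hγ0 : 0 ≤ γ := zero_le_one.trans hγ
  have hj' : (2 : ℝ) ≤ j := by exact_mod_cast hj
  have h_one : 1 ≤ ((j : ℝ) / 2) ^ γ := Real.one_le_rpow (by linarith) hγ0
  have h_le : ((j : ℝ) / 2) ^ γ ≤ ((j - 1 : ℕ) : ℝ) ^ γ := by
    rw [Nat.cast_pred (by omega)]
    exact Real.rpow_le_rpow (by positivity) (by linarith) hγ0
  rw [tmesh_eq_rpow_mul_tmesh_one hT.le γ N (j - 1)]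
  have h_mesh := mul_le_mul_of_nonneg_right h_le (hs0.trans hs1)
  have h_shift := mul_le_mul_of_nonneg_right h_one hs0
  linarith
end

section
/- Let X be a real Banach space, 0<α<1, M>0, σ>0 and γ≥2/(σ+α/2). Fix T>0 and an integer N≥1, with the graded mesh t_i=(iτ)^γ, τ=T^{1/γ}/N, τ_n=t_n−t_{n−1}. Let u:(0,T]→X be three times continuously differentiable with ‖u″(t)‖ ≤ M·t^{σ+α/2−2} and ‖u‴(t)‖ ≤ M·t^{σ+α/2−3} for all t∈(0,T]. For s∈I_i=(t_{i−1},t_i] define e₂(s)=(s−(t_{i−1}+t_i)/2)·u″(t_i), and for 1≤j≤N set η₂^j=∫_{t_{j−1}}^{t_j}(I^α e₂)(t)dt. Then there is a constant C>0, depending only on M, σ, α, γ and T, such that ‖η₂^j‖ ≤ C·τ²·τ_j·t_j^{3α/2+σ−1−2/γ} for all 1≤j≤N. -/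
/-- Riemann–Liouville fractional integral `(I^α v)(t) = ∫₀^t ω_α(t-s) v(s) ds`. -/
noncomputable def Ifrac {X : Type*} [NormedAddCommGroup X] [NormedSpace ℝ X]
    (α : ℝ) (v : ℝ → X) (t : ℝ) : X :=
  ∫ s in (0:ℝ)..t, omegaK α (t - s) • v s

section Mesh

variable {T γ : ℝ} {N : ℕ}

lemma tmesh_eq (hT : 0 < T) (i : ℕ) :
    tmesh T γ N i = (i : ℝ) ^ γ * (T ^ (1 / γ) / N) ^ γ :=
  Real.mul_rpow (Nat.cast_nonneg i) (by positivity)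

lemma meshScale_pos (hT : 0 < T) (hN : 1 ≤ N) : 0 < T ^ (1 / γ) / (N : ℝ) := by
  have : (0:ℝ) < N := by exact_mod_cast hN
  positivity

lemma tmesh_zero (hγ : 1 ≤ γ) : tmesh T γ N 0 = 0 := by
  simp [tmesh, Real.zero_rpow (by linarith : γ ≠ 0)]

lemma tmesh_pos (hT : 0 < T) (hN : 1 ≤ N) {i : ℕ} (hi : 1 ≤ i) : 0 < tmesh T γ N i := by
  have h1 := meshScale_pos (γ := γ) hT hN
  have h2 : (0:ℝ) < i := by exact_mod_cast hi
  unfold tmesh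
  positivity

lemma tmesh_mono (hγ : 1 ≤ γ) (hT : 0 < T) (hN : 1 ≤ N) {i j : ℕ} (hij : i ≤ j) :
    tmesh T γ N i ≤ tmesh T γ N j := by
  have h1 := meshScale_pos (γ := γ) hT hN
  unfold tmesh
  gcongr

lemma tmesh_lt (hγ : 1 ≤ γ) (hT : 0 < T) (hN : 1 ≤ N) {i j : ℕ} (hij : i < j) :
    tmesh T γ N i < tmesh T γ N j := by
  have h1 := meshScale_pos (γ := γ) hT hN
  unfold tmesh
  gcongr

lemma tmesh_last (hγ : 1 ≤ γ) (hT : 0 < T) (hN : 1 ≤ N) : tmesh T γ N N = T := by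
  have h2 : (N : ℝ) ≠ 0 := by exact_mod_cast (by omega : N ≠ 0)
  rw [tmesh, mul_div_cancel₀ _ h2, ← Real.rpow_mul hT.le, one_div_mul_cancel (by linarith),
    Real.rpow_one]

/-- The mesh scale is recovered from the node. -/
lemma tmesh_rpow (hγ : 1 ≤ γ) (hT : 0 < T) (i : ℕ) :
    tmesh T γ N i ^ (1 / γ) = i * (T ^ (1 / γ) / N) := by
  rw [tmesh, ← Real.rpow_mul (by positivity), mul_one_div_cancel (by linarith), Real.rpow_one]

lemma monotone_tmesh_step (hγ : 1 ≤ γ) (hT : 0 < T) :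
    Monotone fun i => tmesh T γ N (i + 1) - tmesh T γ N i := by
  refine monotone_nat_of_le_succ fun i => ?_
  have hc : 0 ≤ (T ^ (1 / γ) / N) ^ γ := by positivity
  have h := (convexOn_rpow hγ).2 (Set.mem_Ici.2 (by positivity : (0:ℝ) ≤ i))
    (Set.mem_Ici.2 (by positivity : (0:ℝ) ≤ i + 2)) (by norm_num : (0:ℝ) ≤ 1 / 2)
    (by norm_num : (0:ℝ) ≤ 1 / 2) (by norm_num)
  simp only [smul_eq_mul] at h
  rw [show 1 / 2 * (i : ℝ) + 1 / 2 * (i + 2) = i + 1 by ring] at h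
  simp only [tmesh_eq hT]
  push_cast
  rw [show (i : ℝ) + 1 + 1 = i + 2 by ring]
  nlinarith

lemma succ_div_rpow_le (hγ : 1 ≤ γ) (i : ℕ) :
    (((i : ℝ) + 2) / (i + 1)) ^ γ ≤ 1 + 2 ^ γ / (i + 1) := by
  have hi : (0:ℝ) < i + 1 := by positivity
  have hy : 1 / ((i : ℝ) + 1) ≤ 1 := by
    rw [div_le_one hi]; linarith [(Nat.cast_nonneg i : (0:ℝ) ≤ i)]
  have h := (convexOn_rpow hγ).2 (Set.mem_Ici.2 (by positivity : (0:ℝ) ≤ 1))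
    (Set.mem_Ici.2 (by positivity : (0:ℝ) ≤ 2)) (by linarith : 0 ≤ 1 - 1 / ((i : ℝ) + 1))
    (by positivity : 0 ≤ 1 / ((i : ℝ) + 1)) (by ring)
  simp only [smul_eq_mul, Real.one_rpow] at h
  rw [show (1 - 1 / ((i : ℝ) + 1)) * 1 + 1 / (i + 1) * 2 = (i + 2) / (i + 1) by
    field_simp; ring] at h
  have : 0 < 1 / ((i : ℝ) + 1) := by positivity
  calc _ ≤ _ := h
    _ ≤ 1 + 1 / ((i : ℝ) + 1) * 2 ^ γ := by linarith
    _ = _ := by ring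

/-- Shifting both end points of an interval of nodes stretches it by a factor `1 + O(1/i)`. -/
lemma tmesh_sub_shift_le (hγ : 1 ≤ γ) (hT : 0 < T) {i j : ℕ} (hij : i ≤ j) :
    tmesh T γ N (j + 2) - tmesh T γ N (i + 2) ≤
      (1 + 2 ^ γ / (i + 1)) * (tmesh T γ N (j + 1) - tmesh T γ N (i + 1)) := by
  have hi : (0:ℝ) < i + 1 := by positivity
  have hij' : (i : ℝ) ≤ j := by exact_mod_cast hij
  have hc : 0 ≤ (T ^ (1 / γ) / N) ^ γ := by positivity
  have h1 : ((j : ℝ) + 2) ^ γ ≤ ((i + 2) / (i + 1)) ^ γ * (j + 1) ^ γ := by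
    rw [← Real.mul_rpow (by positivity) (by positivity)]
    refine Real.rpow_le_rpow (by positivity) ?_ (by linarith)
    rw [div_mul_eq_mul_div, le_div_iff₀ hi]
    nlinarith
  have h2 : ((i : ℝ) + 2) ^ γ = ((i + 2) / (i + 1)) ^ γ * (i + 1) ^ γ := by
    rw [← Real.mul_rpow (by positivity) (by positivity), div_mul_cancel₀ _ hi.ne']
  have h3 : ((i : ℝ) + 1) ^ γ ≤ (j + 1) ^ γ :=
    Real.rpow_le_rpow hi.le (by linarith) (by linarith)
  have h4 := mul_le_mul_of_nonneg_right (succ_div_rpow_le hγ i) (sub_nonneg.2 h3)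
  have h5 : ((j : ℝ) + 2) ^ γ - (i + 2) ^ γ ≤
      (1 + 2 ^ γ / (i + 1)) * ((j + 1) ^ γ - (i + 1) ^ γ) := by linarith
  simp only [tmesh_eq hT]
  push_cast
  calc _ = (((j : ℝ) + 2) ^ γ - (i + 2) ^ γ) * (T ^ (1 / γ) / N) ^ γ := by ring
    _ ≤ _ := mul_le_mul_of_nonneg_right h5 hc
    _ = _ := by ring

lemma tmesh_step_shift_le (hγ : 1 ≤ γ) (hT : 0 < T) (i : ℕ) :
    tmesh T γ N (i + 2) - tmesh T γ N (i + 1) ≤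
      (1 + 2 ^ γ / (i + 1)) * (tmesh T γ N (i + 1) - tmesh T γ N i) := by
  have hi : (0:ℝ) < i + 1 := by positivity
  have hc : 0 ≤ (T ^ (1 / γ) / N) ^ γ := by positivity
  have h1 : (((i : ℝ) + 2) / (i + 1)) ^ γ * i ^ γ ≤ (i + 1) ^ γ := by
    rw [← Real.mul_rpow (by positivity) (by positivity)]
    refine Real.rpow_le_rpow (by positivity) ?_ (by linarith)
    rw [div_mul_eq_mul_div, div_le_iff₀ hi]
    nlinarith
  have h2 : ((i : ℝ) + 2) ^ γ = ((i + 2) / (i + 1)) ^ γ * (i + 1) ^ γ := by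
    rw [← Real.mul_rpow (by positivity) (by positivity), div_mul_cancel₀ _ hi.ne']
  have h3 : (i : ℝ) ^ γ ≤ (i + 1) ^ γ :=
    Real.rpow_le_rpow (by positivity) (by linarith) (by linarith)
  have h4 := mul_le_mul_of_nonneg_right (succ_div_rpow_le hγ i) (sub_nonneg.2 h3)
  have h5 : ((i : ℝ) + 2) ^ γ - (i + 1) ^ γ ≤
      (1 + 2 ^ γ / (i + 1)) * ((i + 1) ^ γ - i ^ γ) := by linarith
  simp only [tmesh_eq hT]
  push_cast
  calc _ = (((i : ℝ) + 2) ^ γ - (i + 1) ^ γ) * (T ^ (1 / γ) / N) ^ γ := by ring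
    _ ≤ _ := mul_le_mul_of_nonneg_right h5 hc
    _ = _ := by ring

/-- Comparison of nodes through the ratio of their indices. -/
lemma tmesh_le_rpow_mul (hγ : 1 ≤ γ) (hT : 0 < T) {i j : ℕ} {r : ℝ} (hr : 0 ≤ r)
    (hij : (i : ℝ) ≤ r * j) : tmesh T γ N i ≤ r ^ γ * tmesh T γ N j := by
  have hc : 0 ≤ (T ^ (1 / γ) / N) ^ γ := by positivity
  rw [tmesh_eq hT, tmesh_eq hT, ← mul_assoc, ← Real.mul_rpow hr (by positivity)]
  exact mul_le_mul_of_nonneg_right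
    (Real.rpow_le_rpow (by positivity) hij (by linarith)) hc

lemma tmesh_step_le (hγ : 1 ≤ γ) (hT : 0 < T) (i : ℕ) :
    tmesh T γ N (i + 1) - tmesh T γ N i ≤ γ / (i + 1) * tmesh T γ N (i + 1) := by
  have hi : (0:ℝ) < i + 1 := by positivity
  have hc : 0 ≤ (T ^ (1 / γ) / N) ^ γ := by positivity
  have hy : 1 / ((i : ℝ) + 1) ≤ 1 := by
    rw [div_le_one hi]; linarith [(Nat.cast_nonneg i : (0:ℝ) ≤ i)]
  have h := one_add_mul_self_le_rpow_one_add (s := -(1 / ((i : ℝ) + 1))) (by linarith) hγ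
  have h1 : (i : ℝ) ^ γ = (1 + -(1 / ((i : ℝ) + 1))) ^ γ * (i + 1) ^ γ := by
    rw [← Real.mul_rpow (by linarith) hi.le]
    congr 1
    field_simp
    ring
  have h2 : 0 ≤ ((i : ℝ) + 1) ^ γ := by positivity
  have h3 : ((i : ℝ) + 1) ^ γ - i ^ γ ≤ γ / (i + 1) * (i + 1) ^ γ := by
    rw [h1]
    have := mul_le_mul_of_nonneg_right h h2
    have e : (1 + γ * -(1 / ((i : ℝ) + 1))) * (i + 1) ^ γ
        = (i + 1) ^ γ - γ / (i + 1) * (i + 1) ^ γ := by ring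
    linarith
  simp only [tmesh_eq hT]
  push_cast
  calc _ = (((i : ℝ) + 1) ^ γ - i ^ γ) * (T ^ (1 / γ) / N) ^ γ := by ring
    _ ≤ _ := mul_le_mul_of_nonneg_right h3 hc
    _ = _ := by ring

lemma le_tmesh_step (hγ : 1 ≤ γ) (hT : 0 < T) (i : ℕ) :
    1 / ((i : ℝ) + 1) * tmesh T γ N (i + 1) ≤ tmesh T γ N (i + 1) - tmesh T γ N i := by
  have hi : (0:ℝ) < i + 1 := by positivity
  have h0 : 0 ≤ tmesh T γ N (i + 1) := by unfold tmesh; positivity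
  have h1 := tmesh_le_rpow_mul (N := N) hγ hT (i := i) (j := i + 1) (r := i / (i + 1))
    (by positivity) (by push_cast; rw [div_mul_cancel₀ _ hi.ne'])
  have h2 : ((i : ℝ) / (i + 1)) ^ γ ≤ i / (i + 1) :=
    Real.rpow_le_self_of_le_one (by positivity) (by rw [div_le_one hi]; linarith) hγ
  have h3 := mul_le_mul_of_nonneg_right h2 h0
  have e : (i : ℝ) / (i + 1) * tmesh T γ N (i + 1)
      = tmesh T γ N (i + 1) - 1 / (i + 1) * tmesh T γ N (i + 1) := by field_simp; ring
  linarith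

lemma two_thirds_tmesh_le (hγ : 1 ≤ γ) (hT : 0 < T) {k j : ℕ} (hk : 3 * k ≤ j) :
    2 / 3 * tmesh T γ N j ≤ tmesh T γ N j - tmesh T γ N k := by
  have h0 : 0 ≤ tmesh T γ N j := by unfold tmesh; positivity
  have hk' : 3 * (k : ℝ) ≤ j := by exact_mod_cast hk
  have h1 := tmesh_le_rpow_mul (N := N) hγ hT (i := k) (j := j) (r := 1 / 3)
    (by norm_num) (by linarith)
  have h2 : (1 / 3 : ℝ) ^ γ ≤ 1 / 3 :=
    Real.rpow_le_self_of_le_one (by norm_num) (by norm_num) hγ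
  nlinarith

lemma tmesh_le_far_sub (hγ : 1 ≤ γ) (hT : 0 < T) {i m : ℕ} (hi : 1 ≤ i) (him : 3 * i ≤ m + 1) :
    tmesh T γ N (m + 1) ≤ 3 ^ γ * (tmesh T γ N m - tmesh T γ N i) := by
  have h0 : 0 ≤ tmesh T γ N i := by unfold tmesh; positivity
  have hm' : 3 * (i : ℝ) ≤ m + 1 := by exact_mod_cast him
  have hi' : (1 : ℝ) ≤ i := by exact_mod_cast hi
  have h1 := tmesh_le_rpow_mul (N := N) hγ hT (i := m + 1) (j := m) (r := 3 / 2)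
    (by norm_num) (by push_cast; linarith)
  have h2 := tmesh_le_rpow_mul (N := N) hγ hT (i := i) (j := m) (r := 1 / 2)
    (by norm_num) (by linarith)
  have h3 : (2 : ℝ) ≤ 2 ^ γ := Real.self_le_rpow_of_one_le (by norm_num) hγ
  have h4 : (3 : ℝ) ^ γ = (3 / 2) ^ γ * 2 ^ γ := by
    rw [← Real.mul_rpow (by norm_num) (by norm_num)]; norm_num
  have h5 : (1 / 2 : ℝ) ^ γ * 2 ^ γ = 1 := by
    rw [← Real.mul_rpow (by norm_num) (by norm_num)]; norm_num
  have h6 : 0 < (3 / 2 : ℝ) ^ γ := by positivity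
  have h7 : tmesh T γ N i * 2 ^ γ ≤ tmesh T γ N m := by
    calc _ ≤ (1 / 2 : ℝ) ^ γ * tmesh T γ N m * 2 ^ γ :=
          mul_le_mul_of_nonneg_right h2 (by positivity)
      _ = ((1 / 2 : ℝ) ^ γ * 2 ^ γ) * tmesh T γ N m := by ring
      _ = _ := by rw [h5, one_mul]
  have h8 : tmesh T γ N m ≤ 2 ^ γ * (tmesh T γ N m - tmesh T γ N i) := by
    have h9 : 0 ≤ tmesh T γ N m := by unfold tmesh; positivity
    nlinarith [mul_le_mul_of_nonneg_right h3 h9]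
  rw [h4, mul_assoc]
  exact h1.trans (mul_le_mul_of_nonneg_left h8 h6.le)

end Mesh

/-- The moment `½ ∫₀^h s (h - s) (x - s)^(α-1) ds`, rescaled to the unit interval. -/
noncomputable def kernelMoment (α h x : ℝ) : ℝ :=
  h ^ 3 / 2 * ∫ θ in (0:ℝ)..1, θ * (1 - θ) * (x - θ * h) ^ (α - 1)

lemma hasDerivAt_sub_rpow {t s p : ℝ} (hs : s < t) :
    HasDerivAt (fun s : ℝ => (t - s) ^ p) (-(p * (t - s) ^ (p - 1))) s := by
  have h := ((hasDerivAt_id s).const_sub t).rpow_const (p := p) (Or.inl (sub_pos.2 hs).ne')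
  refine h.congr_deriv ?_
  simp

lemma intervalIntegrable_sub_rpow {α a b t : ℝ} (hα : 0 < α) :
    IntervalIntegrable (fun s : ℝ => (t - s) ^ (α - 1)) MeasureTheory.volume a b := by
  have h := (intervalIntegral.intervalIntegrable_rpow' (a := t - a) (b := t - b) (r := α - 1)
    (by linarith)).comp_sub_left t
  simpa using h

lemma integral_sub_mul_sub_rpow {α a b c t : ℝ} (hα : 0 < α) (hab : a ≤ b) (hbt : b ≤ t) :
    ∫ s in a..b, (t - s) ^ (α - 1) * (s - c) =
      (a - c) * (t - a) ^ α / α + (t - a) ^ (α + 1) / (α * (α + 1))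
        - (b - c) * (t - b) ^ α / α - (t - b) ^ (α + 1) / (α * (α + 1)) := by
  rw [intervalIntegral.integral_eq_sub_of_hasDerivAt_of_le
    (f := fun s => -((s - c) * (t - s) ^ α / α) - (t - s) ^ (α + 1) / (α * (α + 1))) hab]
  · ring
  · have h0 : (0:ℝ) ≤ α := hα.le
    have h1 : (0:ℝ) ≤ α + 1 := by linarith
    have c1 : Continuous fun s : ℝ => (t - s) ^ α :=
      (continuous_const.sub continuous_id).rpow_const fun _ => Or.inr h0
    have c2 : Continuous fun s : ℝ => (t - s) ^ (α + 1) :=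
      (continuous_const.sub continuous_id).rpow_const fun _ => Or.inr h1
    fun_prop
  · intro s hs
    have hst : s < t := hs.2.trans_le hbt
    have d1 := ((((hasDerivAt_id s).sub_const c).mul
      (hasDerivAt_sub_rpow (p := α) hst)).div_const α).neg.sub
      ((hasDerivAt_sub_rpow (p := α + 1) hst).div_const (α * (α + 1)))
    refine d1.congr_deriv ?_
    simp only [id, add_sub_cancel_right]
    field_simp
    ring
  · exact (intervalIntegrable_sub_rpow hα).mul_continuousOn (by fun_prop)

lemma intervalIntegrable_moment {α h x : ℝ} (hα : 0 < α) (hh : 0 < h) :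
    IntervalIntegrable (fun θ : ℝ => (x - θ * h) ^ (α - 1)) MeasureTheory.volume 0 1 := by
  have hI := (intervalIntegrable_sub_rpow (a := 0) (b := h) (t := x) hα).comp_mul_right (c := h)
  simpa [hh.ne'] using hI

lemma hasDerivAt_sub_mul_rpow {h x θ p : ℝ} (hs : 0 < x - θ * h) :
    HasDerivAt (fun θ : ℝ => (x - θ * h) ^ p) (-(h * p * (x - θ * h) ^ (p - 1))) θ := by
  have h := (((hasDerivAt_id θ).mul_const h).const_sub x).rpow_const (p := p) (Or.inl hs.ne')
  refine h.congr_deriv ?_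
  simp

lemma sub_mul_pos {h x θ : ℝ} (hh : 0 < h) (hx : h ≤ x) (hθ : θ < 1) : 0 < x - θ * h := by
  nlinarith

lemma kernelMoment_eq {α h x : ℝ} (hα : 0 < α) (hh : 0 < h) (hx : h ≤ x) :
    kernelMoment α h x = h / 2 * (x ^ (α + 1) + (x - h) ^ (α + 1)) / (α * (α + 1))
      - (x ^ (α + 2) - (x - h) ^ (α + 2)) / (α * (α + 1) * (α + 2)) := by
  have cont : ∀ p : ℝ, 0 ≤ p → Continuous fun θ : ℝ => (x - θ * h) ^ p := fun p hp =>
    (by fun_prop : Continuous fun θ : ℝ => x - θ * h).rpow_const fun _ => Or.inr hp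
  have c0 := cont α hα.le
  have c1 := cont (α + 1) (by linarith)
  have c2 := cont (α + 2) (by linarith)
  rw [kernelMoment, intervalIntegral.integral_eq_sub_of_hasDerivAt_of_le
    (f := fun θ => -(θ * (1 - θ) * (x - θ * h) ^ α / (α * h))
      - (1 - 2 * θ) * (x - θ * h) ^ (α + 1) / (α * (α + 1) * h ^ 2)
      + 2 * (x - θ * h) ^ (α + 2) / (α * (α + 1) * (α + 2) * h ^ 3)) zero_le_one]
  · simp only [zero_mul, one_mul, sub_zero, mul_one, mul_zero]
    field_simp
    ring
  · fun_prop
  · intro θ hθ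
    have hp := sub_mul_pos hh hx hθ.2
    have d0 := hasDerivAt_sub_mul_rpow (p := α) hp
    have d1 := hasDerivAt_sub_mul_rpow (p := α + 1) hp
    have d2 := hasDerivAt_sub_mul_rpow (p := α + 2) hp
    have e0 := (((hasDerivAt_id θ).mul ((hasDerivAt_id θ).const_sub 1)).mul d0).div_const (α * h)
    have e1 := ((((hasDerivAt_id θ).const_mul 2).const_sub 1).mul d1).div_const
      (α * (α + 1) * h ^ 2)
    have e2 := (d2.const_mul 2).div_const (α * (α + 1) * (α + 2) * h ^ 3)
    refine ((e0.neg.sub e1).add e2).congr_deriv ?_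
    have s2 : α + 2 - 1 = α + 1 := by ring
    simp only [id, add_sub_cancel_right, s2, Pi.mul_apply]
    field_simp
    ring
  · exact (intervalIntegrable_moment hα hh).continuousOn_mul (by fun_prop)

lemma kernelMoment_nonneg {α h x : ℝ} (hh : 0 < h) (hx : h ≤ x) : 0 ≤ kernelMoment α h x := by
  refine mul_nonneg (by positivity) (intervalIntegral.integral_nonneg zero_le_one fun θ hθ => ?_)
  have : 0 ≤ x - θ * h := by nlinarith [hθ.2]
  exact mul_nonneg (mul_nonneg hθ.1 (by linarith [hθ.2])) (Real.rpow_nonneg this _)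

lemma intervalIntegrable_weighted_moment {α h x : ℝ} (hα : 0 < α) (hh : 0 < h) :
    IntervalIntegrable (fun θ : ℝ => θ * (1 - θ) * (x - θ * h) ^ (α - 1))
      MeasureTheory.volume 0 1 :=
  (intervalIntegrable_moment hα hh).continuousOn_mul (by fun_prop)

lemma kernelMoment_le {α h x : ℝ} (hα : 0 < α) (hh : 0 < h) (hx : h ≤ x) :
    kernelMoment α h x ≤ h ^ 2 / (8 * α) * (x ^ α - (x - h) ^ α) := by
  have hI : ∫ θ in (0:ℝ)..1, (x - θ * h) ^ (α - 1) = (x ^ α - (x - h) ^ α) / (α * h) := by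
    rw [intervalIntegral.integral_eq_sub_of_hasDerivAt_of_le
      (f := fun θ => -((x - θ * h) ^ α / (α * h))) zero_le_one]
    · simp only [zero_mul, one_mul, sub_zero]; ring
    · have c0 : Continuous fun θ : ℝ => (x - θ * h) ^ α :=
        (by fun_prop : Continuous fun θ : ℝ => x - θ * h).rpow_const fun _ => Or.inr hα.le
      exact (c0.div_const _).neg.continuousOn
    · intro θ hθ
      refine ((hasDerivAt_sub_mul_rpow (p := α)
        (sub_mul_pos hh hx hθ.2)).div_const (α * h)).neg.congr_deriv ?_
      field_simp
    · exact intervalIntegrable_moment hα hh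
  have hle : ∫ θ in (0:ℝ)..1, θ * (1 - θ) * (x - θ * h) ^ (α - 1)
      ≤ ∫ θ in (0:ℝ)..1, 1 / 4 * (x - θ * h) ^ (α - 1) := by
    refine intervalIntegral.integral_mono_on_of_le_Ioo zero_le_one
      (intervalIntegrable_weighted_moment hα hh) ((intervalIntegrable_moment hα hh).const_mul _)
      fun θ hθ => ?_
    refine mul_le_mul_of_nonneg_right ?_ (Real.rpow_nonneg (sub_mul_pos hh hx hθ.2).le _)
    nlinarith [sq_nonneg (θ - 1 / 2)]
  rw [intervalIntegral.integral_const_mul, hI] at hle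
  calc kernelMoment α h x ≤ h ^ 3 / 2 * (1 / 4 * ((x ^ α - (x - h) ^ α) / (α * h))) :=
        mul_le_mul_of_nonneg_left hle (by positivity)
    _ = _ := by field_simp; ring

lemma abs_kernelMoment_sub_le {α h x h' x' ε : ℝ} (hα : 0 < α) (hα1 : α < 1) (hh : 0 < h')
    (hx : h ≤ x) (hx' : h' ≤ x') (hε : 0 ≤ ε) (h1 : h' ≤ h) (h2 : h ≤ (1 + ε) * h')
    (h3 : x' - h' ≤ x - h) (h4 : x - h ≤ (1 + ε) * (x' - h')) :
    |kernelMoment α h x - kernelMoment α h' x'| ≤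
      (3 + 3 * ε + ε ^ 2) * ε * kernelMoment α h' x' := by
  have hh0 : 0 < h := hh.trans_le h1
  have hg := kernelMoment_nonneg (α := α) hh hx'
  have hI' : 0 ≤ ∫ θ in (0:ℝ)..1, θ * (1 - θ) * (x' - θ * h') ^ (α - 1) :=
    nonneg_of_mul_nonneg_right (a := h' ^ 3 / 2) hg (by positivity)
  have hup : ∫ θ in (0:ℝ)..1, θ * (1 - θ) * (x - θ * h) ^ (α - 1)
      ≤ ∫ θ in (0:ℝ)..1, θ * (1 - θ) * (x' - θ * h') ^ (α - 1) := by
    refine intervalIntegral.integral_mono_on_of_le_Ioo zero_le_one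
      (intervalIntegrable_weighted_moment hα hh0) (intervalIntegrable_weighted_moment hα hh) fun θ hθ => ?_
    refine mul_le_mul_of_nonneg_left ?_ (mul_nonneg hθ.1.le (by linarith [hθ.2]))
    refine Real.rpow_le_rpow_of_nonpos (sub_mul_pos hh hx' hθ.2) ?_ (by linarith)
    nlinarith [hθ.1, hθ.2]
  have hlow : (1 + ε)⁻¹ * ∫ θ in (0:ℝ)..1, θ * (1 - θ) * (x' - θ * h') ^ (α - 1)
      ≤ ∫ θ in (0:ℝ)..1, θ * (1 - θ) * (x - θ * h) ^ (α - 1) := by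
    rw [← intervalIntegral.integral_const_mul]
    refine intervalIntegral.integral_mono_on_of_le_Ioo zero_le_one
      ((intervalIntegrable_weighted_moment hα hh).const_mul _) (intervalIntegrable_weighted_moment hα hh0)
      fun θ hθ => ?_
    have hp' := sub_mul_pos hh hx' hθ.2
    have hp := sub_mul_pos hh0 hx hθ.2
    have key : (1 + ε)⁻¹ * (x' - θ * h') ^ (α - 1) ≤ (x - θ * h) ^ (α - 1) := by
      calc (1 + ε)⁻¹ * (x' - θ * h') ^ (α - 1)
          ≤ (1 + ε) ^ (α - 1) * (x' - θ * h') ^ (α - 1) := by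
            refine mul_le_mul_of_nonneg_right ?_ (Real.rpow_nonneg hp'.le _)
            rw [← Real.rpow_neg_one]
            exact Real.rpow_le_rpow_of_exponent_le (by linarith) (by linarith)
        _ = ((1 + ε) * (x' - θ * h')) ^ (α - 1) :=
            (Real.mul_rpow (by linarith) hp'.le).symm
        _ ≤ _ := Real.rpow_le_rpow_of_nonpos hp (by nlinarith [hθ.1, hθ.2]) (by linarith)
    calc _ = θ * (1 - θ) * ((1 + ε)⁻¹ * (x' - θ * h') ^ (α - 1)) := by ring
      _ ≤ _ := mul_le_mul_of_nonneg_left key (mul_nonneg hθ.1.le (by linarith [hθ.2]))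
  have hinv : 1 - ε ≤ (1 + ε)⁻¹ := by
    rw [← one_div, le_div_iff₀ (by linarith)]
    nlinarith
  rw [abs_le]
  unfold kernelMoment at hg ⊢
  set I := ∫ θ in (0:ℝ)..1, θ * (1 - θ) * (x - θ * h) ^ (α - 1)
  set I' := ∫ θ in (0:ℝ)..1, θ * (1 - θ) * (x' - θ * h') ^ (α - 1)
  have hI : 0 ≤ I := le_trans (by positivity) hlow
  have c1 : h' ^ 3 ≤ h ^ 3 := pow_le_pow_left₀ hh.le h1 3
  have c2 : h ^ 3 ≤ (1 + ε) ^ 3 * h' ^ 3 := by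
    rw [← mul_pow]; exact pow_le_pow_left₀ hh0.le h2 3
  constructor
  · have a1 : (1 - ε) * I' ≤ I := (mul_le_mul_of_nonneg_right hinv hI').trans hlow
    have a2 : h' ^ 3 / 2 * I ≤ h ^ 3 / 2 * I := mul_le_mul_of_nonneg_right (by linarith) hI
    have a3 : h' ^ 3 / 2 * ((1 - ε) * I') ≤ h' ^ 3 / 2 * I :=
      mul_le_mul_of_nonneg_left a1 (by positivity)
    have a4 : 0 ≤ (2 + 3 * ε + ε ^ 2) * ε * (h' ^ 3 / 2 * I') := by positivity
    nlinarith
  · have a1 : h ^ 3 / 2 * I ≤ (1 + ε) ^ 3 * h' ^ 3 / 2 * I' :=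
      mul_le_mul (by linarith) hup hI (by positivity)
    nlinarith

/-- The weight of the `i`-th mesh interval in the fractional integral up to the node `t_j`. -/
noncomputable def meshMoment (T γ α : ℝ) (N i j : ℕ) : ℝ :=
  kernelMoment α (tmesh T γ N (i + 1) - tmesh T γ N i) (tmesh T γ N j - tmesh T γ N i)

lemma sum_Ico_sub_succ (f : ℕ → ℝ) {k m : ℕ} (hkm : k ≤ m) :
    ∑ i ∈ Finset.Ico k m, (f i - f (i + 1)) = f k - f m := by
  induction m, hkm using Nat.le_induction with
  | base => simp
  | succ n hn ih => rw [Finset.sum_Ico_succ_top hn, ih]; ring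

/-- `stretchConst γ / j` bounds the relative distortion of the mesh near the node `t_j`. -/
noncomputable def stretchConst (γ : ℝ) : ℝ := 3 * γ * 3 ^ γ

/-- Constant in the perturbation bounds for `meshMoment`. -/
noncomputable def perturbConst (γ : ℝ) : ℝ :=
  (3 + 3 * stretchConst γ + stretchConst γ ^ 2) * stretchConst γ

section Weights

variable {T γ α : ℝ} {N : ℕ}

lemma stretchConst_pos (hγ : 1 ≤ γ) : 0 < stretchConst γ := by
  unfold stretchConst; positivity

lemma meshMoment_nonneg (hγ : 1 ≤ γ) (hT : 0 < T) (hN : 1 ≤ N) {i j : ℕ} (hij : i + 1 ≤ j) :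
    0 ≤ meshMoment T γ α N i j :=
  kernelMoment_nonneg (sub_pos.2 (tmesh_lt hγ hT hN i.lt_succ_self))
    (sub_le_sub_right (tmesh_mono hγ hT hN hij) _)

lemma meshMoment_le (hα : 0 < α) (hγ : 1 ≤ γ) (hT : 0 < T) (hN : 1 ≤ N) {i j : ℕ}
    (hij : i + 1 ≤ j) :
    meshMoment T γ α N i j ≤ (tmesh T γ N (i + 1) - tmesh T γ N i) ^ 2 *
      (((tmesh T γ N j - tmesh T γ N i) ^ α - (tmesh T γ N j - tmesh T γ N (i + 1)) ^ α) /
        (8 * α)) := by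
  refine (kernelMoment_le hα (sub_pos.2 (tmesh_lt hγ hT hN i.lt_succ_self))
    (sub_le_sub_right (tmesh_mono hγ hT hN hij) _)).trans_eq ?_
  rw [sub_sub_sub_cancel_right]
  ring

lemma perturb_le (hγ : 1 ≤ γ) (m : ℕ) :
    (3 + 3 * (stretchConst γ / (m + 1)) + (stretchConst γ / (m + 1)) ^ 2) *
      (stretchConst γ / (m + 1)) ≤ perturbConst γ / (m + 1) := by
  have h0 := stretchConst_pos hγ
  have h1 : stretchConst γ / ((m : ℝ) + 1) ≤ stretchConst γ :=
    div_le_self h0.le (by linarith [(Nat.cast_nonneg m : (0:ℝ) ≤ m)])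
  have h2 : 0 ≤ stretchConst γ / ((m : ℝ) + 1) := by positivity
  rw [perturbConst, mul_div_assoc]
  gcongr

/-- Moving the evaluation node changes the weight of a distant interval only slightly. -/
lemma abs_meshMoment_sub_far (hα : 0 < α) (hα1 : α < 1) (hγ : 1 ≤ γ) (hT : 0 < T) (hN : 1 ≤ N)
    {i m : ℕ} (him : 3 * (i + 1) ≤ m + 1) :
    |meshMoment T γ α N i (m + 1) - meshMoment T γ α N i m| ≤
      perturbConst γ / (m + 1) * meshMoment T γ α N i m := by
  have hE := stretchConst_pos hγ
  have hE' : 0 ≤ stretchConst γ / ((m : ℝ) + 1) := by positivity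
  have hH := sub_pos.2 (tmesh_lt hγ hT hN i.lt_succ_self)
  have h1 := sub_le_sub_right (tmesh_mono hγ hT hN (by omega : i + 1 ≤ m)) (tmesh T γ N i)
  have h2 := tmesh_mono hγ hT hN m.le_succ
  have h3 := tmesh_le_far_sub (N := N) hγ hT (by omega : 1 ≤ i + 1) him
  have h4 := tmesh_step_le (N := N) hγ hT m
  have h5 : γ / ((m : ℝ) + 1) * tmesh T γ N (m + 1) ≤
      stretchConst γ / (m + 1) * (tmesh T γ N m - tmesh T γ N (i + 1)) := by
    have h6 := sub_nonneg.2 (tmesh_mono hγ hT hN (by omega : i + 1 ≤ m))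
    have h7 : 0 ≤ γ / ((m : ℝ) + 1) := by positivity
    calc _ ≤ γ / ((m : ℝ) + 1) * (3 ^ γ * (tmesh T γ N m - tmesh T γ N (i + 1))) :=
          mul_le_mul_of_nonneg_left h3 h7
      _ ≤ 3 * (γ / ((m : ℝ) + 1) * (3 ^ γ * (tmesh T γ N m - tmesh T γ N (i + 1)))) := by
          have : 0 ≤ γ / ((m : ℝ) + 1) * (3 ^ γ * (tmesh T γ N m - tmesh T γ N (i + 1))) := by
            positivity
          linarith
      _ = _ := by unfold stretchConst; ring
  refine (abs_kernelMoment_sub_le hα hα1 hH (by linarith) h1 hE' le_rfl ?_ ?_ ?_).trans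
    (mul_le_mul_of_nonneg_right (perturb_le hγ m)
      (meshMoment_nonneg hγ hT hN (by omega)))
  · nlinarith
  · linarith
  · rw [sub_sub_sub_cancel_right, sub_sub_sub_cancel_right]
    linarith

/-- Shifting both the interval and the evaluation node changes the weight only slightly. -/
lemma abs_meshMoment_sub_shift (hα : 0 < α) (hα1 : α < 1) (hγ : 1 ≤ γ) (hT : 0 < T)
    (hN : 1 ≤ N) {i m : ℕ} (him : i + 1 ≤ m) (hi : m + 1 ≤ 3 * (i + 1)) :
    |meshMoment T γ α N (i + 1) (m + 1) - meshMoment T γ α N i m| ≤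
      perturbConst γ / (m + 1) * meshMoment T γ α N i m := by
  have hE := stretchConst_pos hγ
  have hE' : 0 ≤ stretchConst γ / ((m : ℝ) + 1) := by positivity
  have hH := sub_pos.2 (tmesh_lt hγ hT hN i.lt_succ_self)
  have h1 := sub_le_sub_right (tmesh_mono hγ hT hN him) (tmesh T γ N i)
  have h2 := sub_le_sub_right (tmesh_mono hγ hT hN (by omega : i + 1 + 1 ≤ m + 1))
    (tmesh T γ N (i + 1))
  have hr : 2 ^ γ / ((i : ℝ) + 1) ≤ stretchConst γ / (m + 1) := by
    have hi' : (m : ℝ) + 1 ≤ 3 * (i + 1) := by exact_mod_cast hi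
    have h6 : (2:ℝ) ^ γ ≤ γ * 3 ^ γ := by
      calc (2:ℝ) ^ γ ≤ 3 ^ γ := by gcongr; norm_num
        _ ≤ γ * 3 ^ γ := le_mul_of_one_le_left (by positivity) hγ
    rw [div_le_div_iff₀ (by positivity) (by positivity), stretchConst]
    calc (2:ℝ) ^ γ * (m + 1) ≤ (γ * 3 ^ γ) * (3 * (i + 1)) := by gcongr
      _ = _ := by ring
  have h3 := monotone_tmesh_step (N := N) hγ hT (by omega : i ≤ i + 1)
  have h4 := monotone_tmesh_step (N := N) hγ hT him
  have h5 := tmesh_step_shift_le (N := N) hγ hT i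
  have h6 := sub_nonneg.2 (tmesh_mono hγ hT hN him)
  obtain ⟨n, rfl⟩ : ∃ n, m = n + 1 := ⟨m - 1, by omega⟩
  have h7 := tmesh_sub_shift_le (N := N) hγ hT (by omega : i ≤ n)
  dsimp only at h3 h4
  refine (abs_kernelMoment_sub_le hα hα1 hH h2 h1 hE' h3 (h5.trans ?_) ?_ ?_).trans
    (mul_le_mul_of_nonneg_right (perturb_le hγ (n + 1))
      (meshMoment_nonneg hγ hT hN him))
  · gcongr
  · rw [sub_sub_sub_cancel_right, sub_sub_sub_cancel_right]
    linarith
  · rw [sub_sub_sub_cancel_right, sub_sub_sub_cancel_right]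
    exact h7.trans (by gcongr)

end Weights

lemma rpow_sub_rpow_le {α x y : ℝ} (hα1 : α < 1) (hy : 0 ≤ y) (hyx : y ≤ x)
    (hx : 0 < x) : x ^ α - y ^ α ≤ x ^ (α - 1) * (x - y) := by
  rcases hy.eq_or_lt with rfl | hy
  · rw [Real.rpow_sub_one hx.ne', sub_zero, div_mul_cancel₀ _ hx.ne']
    linarith [Real.rpow_nonneg le_rfl α]
  · have h := Real.rpow_le_rpow_of_nonpos hy hyx (by linarith : α - 1 ≤ 0)
    have e1 : x ^ α = x ^ (α - 1) * x := by
      rw [Real.rpow_sub_one hx.ne', div_mul_cancel₀ _ hx.ne']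
    have e2 : y ^ α = y ^ (α - 1) * y := by
      rw [Real.rpow_sub_one hy.ne', div_mul_cancel₀ _ hy.ne']
    rw [e1, e2]
    nlinarith

/-- Constant in `norm_sum_meshMoment_sub_le`. -/
noncomputable def differenceConst (γ α : ℝ) : ℝ :=
  (2 * perturbConst γ + 3 / 2 * γ + 1) / (8 * α)

/-- Discrete core of the estimate: the difference of two consecutive weighted sums. -/
lemma norm_sum_meshMoment_sub_le {X : Type*} [NormedAddCommGroup X] [NormedSpace ℝ X]
    {T γ α : ℝ} {N : ℕ} (hα : 0 < α) (hα1 : α < 1) (hγ : 1 ≤ γ) (hT : 0 < T) (hN : 1 ≤ N)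
    {m : ℕ} {P : ℝ} (U : ℕ → X)
    (hU : ∀ i ≤ m, (tmesh T γ N (i + 1) - tmesh T γ N i) ^ 2 * ‖U i‖ ≤ P)
    (hdU : ∀ i, i + 1 ≤ m → m + 1 ≤ 3 * (i + 1) →
      (tmesh T γ N (i + 2) - tmesh T γ N (i + 1)) ^ 2 * ‖U (i + 1) - U i‖ ≤ P / (m + 1)) :
    ‖∑ i ∈ Finset.range (m + 1), meshMoment T γ α N i (m + 1) • U i
        - ∑ i ∈ Finset.range m, meshMoment T γ α N i m • U i‖ ≤
      differenceConst γ α * (P / (m + 1) * tmesh T γ N (m + 1) ^ α) := by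
  set t := tmesh T γ N with ht
  set G := meshMoment T γ α N with hG
  set W : ℕ → ℕ → ℝ := fun i j => (t j - t i) ^ α - (t j - t (i + 1)) ^ α with hW
  have htm : ∀ {i j}, i ≤ j → t i ≤ t j := fun h => tmesh_mono hγ hT hN h
  have ht0 : t 0 = 0 := tmesh_zero hγ
  have hP : 0 ≤ P := le_trans (by positivity) (hU 0 m.zero_le)
  have hWnn : ∀ {i j}, i + 1 ≤ j → 0 ≤ W i j := fun {i j} h =>
    sub_nonneg.2 (Real.rpow_le_rpow (sub_nonneg.2 (htm h))
      (sub_le_sub_left (htm i.le_succ) _) hα.le)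
  have hGn : ∀ {i j}, i + 1 ≤ j → 0 ≤ G i j := fun h => meshMoment_nonneg hγ hT hN h
  have hGle : ∀ {i j} (v : X) (Q : ℝ), i + 1 ≤ j → (t (i + 1) - t i) ^ 2 * ‖v‖ ≤ Q →
      G i j * ‖v‖ ≤ Q * (W i j / (8 * α)) := by
    intro i j v Q hij hv
    calc G i j * ‖v‖ ≤ (t (i + 1) - t i) ^ 2 * (W i j / (8 * α)) * ‖v‖ :=
          mul_le_mul_of_nonneg_right (meshMoment_le hα hγ hT hN hij) (norm_nonneg _)
      _ = (t (i + 1) - t i) ^ 2 * ‖v‖ * (W i j / (8 * α)) := by ring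
      _ ≤ _ := mul_le_mul_of_nonneg_right hv (div_nonneg (hWnn hij) (by positivity))
  have hpc : 0 ≤ perturbConst γ / ((m : ℝ) + 1) := by
    have := stretchConst_pos hγ
    unfold perturbConst
    positivity
  set k := (m + 1) / 3 with hk
  have hkm : k ≤ m := by omega
  have hsplit : ∑ i ∈ Finset.range (m + 1), G i (m + 1) • U i - ∑ i ∈ Finset.range m, G i m • U i
      = ∑ i ∈ Finset.Ico 0 k, (G i (m + 1) - G i m) • U i + G k (m + 1) • U k
        + ∑ i ∈ Finset.Ico k m, (G (i + 1) (m + 1) • U (i + 1) - G i m • U i) := by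
    rw [← Finset.sum_range_add_sum_Ico _ (by omega : k ≤ m + 1),
      ← Finset.sum_range_add_sum_Ico _ hkm,
      Finset.sum_eq_sum_Ico_succ_bot (by omega : k < m + 1),
      ← Finset.sum_Ico_add' (fun i => G i (m + 1) • U i) k m 1, Finset.sum_sub_distrib,
      Nat.Ico_zero_eq_range]
    simp only [sub_smul, Finset.sum_sub_distrib]
    abel
  have hsumW : ∀ {a b : ℕ}, a ≤ b → b ≤ m →
      ∑ i ∈ Finset.Ico a b, W i m ≤ t (m + 1) ^ α := by
    intro a b hab hbm
    rw [sum_Ico_sub_succ (fun i => (t m - t i) ^ α) hab]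
    have h1 : 0 ≤ (t m - t b) ^ α := Real.rpow_nonneg (sub_nonneg.2 (htm hbm)) _
    have h2 : (t m - t a) ^ α ≤ t (m + 1) ^ α := by
      refine Real.rpow_le_rpow (sub_nonneg.2 (htm (hab.trans hbm))) ?_ hα.le
      linarith [htm m.le_succ, htm a.zero_le]
    linarith
  have hsumW' : ∑ i ∈ Finset.Ico k m, W (i + 1) (m + 1) ≤ t (m + 1) ^ α := by
    rw [sum_Ico_sub_succ (fun i => (t (m + 1) - t (i + 1)) ^ α) hkm, sub_self,
      Real.zero_rpow hα.ne', sub_zero]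
    refine Real.rpow_le_rpow (sub_nonneg.2 (htm (by omega))) ?_ hα.le
    linarith [htm (k + 1).zero_le]
  have hfar : ‖∑ i ∈ Finset.Ico 0 k, (G i (m + 1) - G i m) • U i‖ ≤
      perturbConst γ / (m + 1) * (P / (8 * α)) * t (m + 1) ^ α := by
    refine (norm_sum_le_of_le _ (f := fun i => (G i (m + 1) - G i m) • U i)
      (n := fun i => perturbConst γ / (m + 1) * (P / (8 * α)) * W i m)
      fun i hi => ?_).trans ?_
    · have hik := (Finset.mem_Ico.1 hi).2
      rw [norm_smul, Real.norm_eq_abs]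
      calc _ ≤ perturbConst γ / (m + 1) * G i m * ‖U i‖ := mul_le_mul_of_nonneg_right
            (abs_meshMoment_sub_far hα hα1 hγ hT hN (by omega)) (norm_nonneg _)
        _ = perturbConst γ / (m + 1) * (G i m * ‖U i‖) := by ring
        _ ≤ perturbConst γ / (m + 1) * (P * (W i m / (8 * α))) :=
            mul_le_mul_of_nonneg_left (hGle _ _ (by omega) (hU i (by omega))) hpc
        _ = _ := by ring
    · rw [← Finset.mul_sum]
      exact mul_le_mul_of_nonneg_left (hsumW k.zero_le hkm) (by positivity)
  have hbdry : ‖G k (m + 1) • U k‖ ≤ P / (8 * α) * (3 / 2 * γ / (m + 1) * t (m + 1) ^ α) := by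
    have htp : 0 < t (m + 1) := tmesh_pos hT hN (by omega)
    have h23 := two_thirds_tmesh_le (N := N) hγ hT (by omega : 3 * k ≤ m + 1)
    rw [← ht] at h23
    have hW1 : W k (m + 1) ≤ 3 / 2 * γ / (m + 1) * t (m + 1) ^ α := by
      have h1 := rpow_sub_rpow_le hα1 (sub_nonneg.2 (htm (by omega : k + 1 ≤ m + 1)))
        (sub_le_sub_left (htm k.le_succ) _) (by linarith : 0 < t (m + 1) - t k)
      have h2 : (t (m + 1) - t k) ^ (α - 1) ≤ 3 / 2 * t (m + 1) ^ (α - 1) := by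
        calc _ ≤ (2 / 3 * t (m + 1)) ^ (α - 1) :=
              Real.rpow_le_rpow_of_nonpos (by positivity) h23 (by linarith)
          _ = (2 / 3) ^ (α - 1) * t (m + 1) ^ (α - 1) :=
              Real.mul_rpow (by norm_num) htp.le
          _ ≤ (2 / 3) ^ (-1 : ℝ) * t (m + 1) ^ (α - 1) := by
              refine mul_le_mul_of_nonneg_right ?_ (by positivity)
              exact Real.rpow_le_rpow_of_exponent_ge (by norm_num) (by norm_num) (by linarith)
          _ = _ := by rw [Real.rpow_neg_one]; norm_num
      have h3 : t (k + 1) - t k ≤ γ / (m + 1) * t (m + 1) :=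
        (monotone_tmesh_step (N := N) hγ hT hkm).trans (tmesh_step_le hγ hT m)
      have h4 : t (m + 1) ^ α = t (m + 1) ^ (α - 1) * t (m + 1) := by
        rw [Real.rpow_sub_one htp.ne', div_mul_cancel₀ _ htp.ne']
      calc W k (m + 1) ≤ _ := h1
        _ = (t (m + 1) - t k) ^ (α - 1) * (t (k + 1) - t k) := by ring
        _ ≤ (3 / 2 * t (m + 1) ^ (α - 1)) * (γ / (m + 1) * t (m + 1)) :=
            mul_le_mul h2 h3 (sub_nonneg.2 (htm k.le_succ)) (by positivity)
        _ = _ := by rw [h4]; ring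
    rw [norm_smul, Real.norm_of_nonneg (hGn (by omega))]
    calc _ ≤ P * (W k (m + 1) / (8 * α)) := hGle _ _ (by omega) (hU k hkm)
      _ = P / (8 * α) * W k (m + 1) := by ring
      _ ≤ _ := mul_le_mul_of_nonneg_left hW1 (by positivity)
  have hnear : ‖∑ i ∈ Finset.Ico k m, (G (i + 1) (m + 1) • U (i + 1) - G i m • U i)‖ ≤
      perturbConst γ / (m + 1) * (P / (8 * α)) * t (m + 1) ^ α
        + P / (m + 1) / (8 * α) * t (m + 1) ^ α := by
    refine (norm_sum_le_of_le _ (f := fun i => G (i + 1) (m + 1) • U (i + 1) - G i m • U i)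
      (n := fun i => perturbConst γ / (m + 1) * (P / (8 * α)) * W i m
        + P / (m + 1) / (8 * α) * W (i + 1) (m + 1))
      fun i hi => ?_).trans ?_
    · have hik := Finset.mem_Ico.1 hi
      have e : G (i + 1) (m + 1) • U (i + 1) - G i m • U i
          = (G (i + 1) (m + 1) - G i m) • U i + G (i + 1) (m + 1) • (U (i + 1) - U i) := by
        rw [sub_smul, smul_sub]; abel
      rw [e]
      refine (norm_add_le _ _).trans (add_le_add ?_ ?_)
      · rw [norm_smul, Real.norm_eq_abs]
        calc _ ≤ perturbConst γ / (m + 1) * G i m * ‖U i‖ := mul_le_mul_of_nonneg_right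
              (abs_meshMoment_sub_shift hα hα1 hγ hT hN (by omega) (by omega)) (norm_nonneg _)
          _ = perturbConst γ / (m + 1) * (G i m * ‖U i‖) := by ring
          _ ≤ perturbConst γ / (m + 1) * (P * (W i m / (8 * α))) :=
              mul_le_mul_of_nonneg_left (hGle _ _ (by omega) (hU i (by omega))) hpc
          _ = _ := by ring
      · rw [norm_smul, Real.norm_of_nonneg (hGn (by omega))]
        refine (hGle _ _ (by omega) (hdU i (by omega) (by omega))).trans_eq ?_
        ring
    · rw [Finset.sum_add_distrib, ← Finset.mul_sum, ← Finset.mul_sum]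
      exact add_le_add (mul_le_mul_of_nonneg_left (hsumW hkm le_rfl) (by positivity))
        (mul_le_mul_of_nonneg_left hsumW' (by positivity))
  rw [hsplit]
  calc _ ≤ _ := norm_add₃_le
    _ ≤ _ := add_le_add (add_le_add hfar hbdry) hnear
    _ = _ := by unfold differenceConst; field_simp; ring

open MeasureTheory in
lemma integral_linear_rpow {α a c p q : ℝ} (hα : 0 < α) (hap : a ≤ p) (hpq : p ≤ q) :
    IntervalIntegrable
        (fun t : ℝ => c * (t - a) ^ α / α + (t - a) ^ (α + 1) / (α * (α + 1))) volume p q ∧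
      ∫ t in p..q, (c * (t - a) ^ α / α + (t - a) ^ (α + 1) / (α * (α + 1))) =
        (c * (q - a) ^ (α + 1) / (α * (α + 1))
            + (q - a) ^ (α + 2) / (α * (α + 1) * (α + 2)))
          - (c * (p - a) ^ (α + 1) / (α * (α + 1))
            + (p - a) ^ (α + 2) / (α * (α + 1) * (α + 2))) := by
  have cont : ∀ r : ℝ, 0 ≤ r → Continuous fun t : ℝ => (t - a) ^ r := fun r hr =>
    (continuous_id.sub continuous_const).rpow_const fun _ => Or.inr hr
  have c0 := cont α hα.le
  have c1 := cont (α + 1) (by linarith)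
  have c2 := cont (α + 2) (by linarith)
  have hint : IntervalIntegrable
      (fun t : ℝ => c * (t - a) ^ α / α + (t - a) ^ (α + 1) / (α * (α + 1))) volume p q :=
    (by fun_prop : Continuous _).intervalIntegrable p q
  refine ⟨hint, ?_⟩
  refine intervalIntegral.integral_eq_sub_of_hasDerivAt_of_le
    (f := fun t => c * (t - a) ^ (α + 1) / (α * (α + 1))
      + (t - a) ^ (α + 2) / (α * (α + 1) * (α + 2))) hpq
    (by fun_prop : Continuous _).continuousOn (fun t ht => ?_) hint
  have hpos : t - a ≠ 0 := (sub_pos.2 (hap.trans_lt ht.1)).ne'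
  have d : ∀ r : ℝ, HasDerivAt (fun t : ℝ => (t - a) ^ r) (r * (t - a) ^ (r - 1)) t := fun r => by
    have h := ((hasDerivAt_id t).sub_const a).rpow_const (p := r) (Or.inl hpos)
    refine h.congr_deriv ?_
    simp
  refine ((((d (α + 1)).const_mul c).div_const _).add ((d (α + 2)).div_const _)).congr_deriv ?_
  rw [show α + 1 - 1 = α by ring, show α + 2 - 1 = α + 1 by ring]
  field_simp

open MeasureTheory in
lemma integral_offDiagonal {α a b p q : ℝ} (hα : 0 < α) (hab : a < b) (hbp : b ≤ p)
    (hpq : p ≤ q) :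
    IntervalIntegrable
        (fun t => ∫ s in a..b, (t - s) ^ (α - 1) * (s - (a + b) / 2)) volume p q ∧
      ∫ t in p..q, ∫ s in a..b, (t - s) ^ (α - 1) * (s - (a + b) / 2) =
        -(kernelMoment α (b - a) (q - a) - kernelMoment α (b - a) (p - a)) := by
  obtain ⟨i1, e1⟩ := integral_linear_rpow (c := a - (a + b) / 2) hα (hab.le.trans hbp) hpq
  obtain ⟨i2, e2⟩ := integral_linear_rpow (c := b - (a + b) / 2) hα hbp hpq
  have hE : Set.EqOn
      (fun t => ((a - (a + b) / 2) * (t - a) ^ α / α + (t - a) ^ (α + 1) / (α * (α + 1)))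
        - ((b - (a + b) / 2) * (t - b) ^ α / α + (t - b) ^ (α + 1) / (α * (α + 1))))
      (fun t => ∫ s in a..b, (t - s) ^ (α - 1) * (s - (a + b) / 2)) (Set.Icc p q) := by
    intro t ht
    dsimp only
    rw [integral_sub_mul_sub_rpow hα hab.le (hbp.trans ht.1)]
    ring
  refine ⟨(i1.sub i2).congr (hE.mono ?_), ?_⟩
  · rw [Set.uIoc_of_le hpq]; exact Set.Ioc_subset_Icc_self
  · rw [← intervalIntegral.integral_congr (by rw [Set.uIcc_of_le hpq]; exact hE),
      intervalIntegral.integral_sub i1 i2, e1, e2,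
      kernelMoment_eq hα (sub_pos.2 hab) (by linarith),
      kernelMoment_eq hα (sub_pos.2 hab) (by linarith),
      sub_sub_sub_cancel_right, sub_sub_sub_cancel_right]
    ring

open MeasureTheory in
lemma integral_diagonal {α a b : ℝ} (hα : 0 < α) (hab : a < b) :
    IntervalIntegrable
        (fun t => ∫ s in a..t, (t - s) ^ (α - 1) * (s - (a + b) / 2)) volume a b ∧
      ∫ t in a..b, ∫ s in a..t, (t - s) ^ (α - 1) * (s - (a + b) / 2) =
        -kernelMoment α (b - a) (b - a) := by
  obtain ⟨i1, e1⟩ := integral_linear_rpow (c := a - (a + b) / 2) hα le_rfl hab.le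
  have hE : Set.EqOn
      (fun t => (a - (a + b) / 2) * (t - a) ^ α / α + (t - a) ^ (α + 1) / (α * (α + 1)))
      (fun t => ∫ s in a..t, (t - s) ^ (α - 1) * (s - (a + b) / 2)) (Set.Icc a b) := by
    intro t ht
    dsimp only
    rw [integral_sub_mul_sub_rpow hα ht.1 le_rfl, sub_self t, Real.zero_rpow hα.ne',
      Real.zero_rpow (by linarith : α + 1 ≠ 0)]
    ring
  refine ⟨i1.congr (hE.mono ?_), ?_⟩
  · rw [Set.uIoc_of_le hab.le]; exact Set.Ioc_subset_Icc_self
  · rw [← intervalIntegral.integral_congr (by rw [Set.uIcc_of_le hab.le]; exact hE), e1,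
      kernelMoment_eq hα (sub_pos.2 hab) le_rfl]
    simp only [sub_self, Real.zero_rpow (by linarith : α + 1 ≠ 0),
      Real.zero_rpow (by linarith : α + 2 ≠ 0)]
    ring

section Integral

variable {X : Type*} [NormedAddCommGroup X] [NormedSpace ℝ X]

open MeasureTheory in
lemma integral_kernel_smul_piece [CompleteSpace X] {α a b b' t : ℝ} (hα : 0 < α) (hab : a ≤ b')
    (hb : b' ≤ b)
    {e : ℝ → X} {U : X} (he : ∀ s ∈ Set.Ioc a b, e s = (s - (a + b) / 2) • U) :
    IntervalIntegrable (fun s => omegaK α (t - s) • e s) volume a b' ∧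
      ∫ s in a..b', omegaK α (t - s) • e s =
        ((∫ s in a..b', (t - s) ^ (α - 1) * (s - (a + b) / 2)) / Real.Gamma α) • U := by
  have hE : Set.EqOn
      (fun s => ((t - s) ^ (α - 1) * (s - (a + b) / 2) / Real.Gamma α) • U)
      (fun s => omegaK α (t - s) • e s) (Set.Ioc a b') := by
    intro s hs
    dsimp only
    rw [he s ⟨hs.1, hs.2.trans hb⟩, omegaK, smul_smul]
    ring_nf
  have hI : IntervalIntegrable
      (fun s => (t - s) ^ (α - 1) * (s - (a + b) / 2) / Real.Gamma α) volume a b' :=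
    ((intervalIntegrable_sub_rpow hα).mul_continuousOn (by fun_prop)).div_const _
  constructor
  · refine IntervalIntegrable.congr ?_ (hI.smul_continuousOn (continuousOn_const (c := U)))
    rwa [Set.uIoc_of_le hab]
  · rw [← intervalIntegral.integral_congr_Ioo_of_le hab (hE.mono Set.Ioo_subset_Ioc_self),
      intervalIntegral.integral_smul_const, intervalIntegral.integral_div]

open MeasureTheory in
/-- The integral of the fractional integral over one step, in terms of the weights. -/
lemma integral_Ifrac_eq [CompleteSpace X] {T γ α : ℝ} {N : ℕ} (hα : 0 < α) (hγ : 1 ≤ γ)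
    (hT : 0 < T) (hN : 1 ≤ N) {m : ℕ} {e : ℝ → X} {U : ℕ → X}
    (he : ∀ i ≤ m, ∀ s ∈ Set.Ioc (tmesh T γ N i) (tmesh T γ N (i + 1)),
      e s = (s - (tmesh T γ N i + tmesh T γ N (i + 1)) / 2) • U i) :
    ∫ t in tmesh T γ N m..tmesh T γ N (m + 1), Ifrac α e t =
      -((Real.Gamma α)⁻¹ • (∑ i ∈ Finset.range (m + 1), meshMoment T γ α N i (m + 1) • U i
        - ∑ i ∈ Finset.range m, meshMoment T γ α N i m • U i)) := by
  set x := tmesh T γ N with hx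
  have hlt : ∀ i, x i < x (i + 1) := fun i => tmesh_lt hγ hT hN i.lt_succ_self
  set φ : ℕ → ℝ → ℝ := fun i t =>
    ∫ s in x i..x (i + 1), (t - s) ^ (α - 1) * (s - (x i + x (i + 1)) / 2) with hφ
  set ψ : ℝ → ℝ := fun t =>
    ∫ s in x m..t, (t - s) ^ (α - 1) * (s - (x m + x (m + 1)) / 2) with hψ
  have hI : Set.EqOn (Ifrac α e)
      (fun t => (∑ i ∈ Finset.range m, (φ i t / Real.Gamma α) • U i)
        + (ψ t / Real.Gamma α) • U m) (Set.Ioo (x m) (x (m + 1))) := by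
    intro t ht
    have hp : ∀ i < m, _ := fun i hi => integral_kernel_smul_piece (t := t) hα (hlt i).le le_rfl
      (he i hi.le)
    obtain ⟨il, el⟩ := integral_kernel_smul_piece (t := t) hα ht.1.le ht.2.le (he m le_rfl)
    have i0 := IntervalIntegrable.trans_iterate (a := x) fun i hi => (hp i hi).1
    have x0 : x 0 = 0 := tmesh_zero hγ
    dsimp only
    rw [Ifrac, ← x0, ← intervalIntegral.integral_add_adjacent_intervals i0 il, el,
      ← intervalIntegral.sum_integral_adjacent_intervals fun i hi => (hp i hi).1]
    congr 1
    exact Finset.sum_congr rfl fun i hi => (hp i (Finset.mem_range.1 hi)).2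
  have hoff : ∀ i ∈ Finset.range m, _ := fun i hi => integral_offDiagonal hα (hlt i)
    (tmesh_mono hγ hT hN (Finset.mem_range.1 hi)) (hlt m).le
  obtain ⟨dI, dE⟩ := integral_diagonal hα (hlt m)
  have hsI : ∀ i ∈ Finset.range m, IntervalIntegrable
      (fun t => (φ i t / Real.Gamma α) • U i) volume (x m) (x (m + 1)) := fun i hi =>
    ((hoff i hi).1.div_const _).smul_continuousOn continuousOn_const
  have hsum : IntervalIntegrable (fun t => ∑ i ∈ Finset.range m, (φ i t / Real.Gamma α) • U i)
      volume (x m) (x (m + 1)) := by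
    have := IntervalIntegrable.sum _ hsI
    simpa only [Finset.sum_fn] using this
  rw [intervalIntegral.integral_congr_Ioo_of_le (hlt m).le hI,
    intervalIntegral.integral_add hsum ((dI.div_const _).smul_continuousOn continuousOn_const),
    intervalIntegral.integral_finsetSum hsI, intervalIntegral.integral_smul_const,
    intervalIntegral.integral_div, dE, Finset.sum_range_succ, smul_sub, smul_add, neg_sub,
    Finset.smul_sum, Finset.smul_sum]
  have hterm : ∀ i ∈ Finset.range m,
      ∫ t in x m..x (m + 1), (φ i t / Real.Gamma α) • U i =
        (Real.Gamma α)⁻¹ • meshMoment T γ α N i m • U i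
          - (Real.Gamma α)⁻¹ • meshMoment T γ α N i (m + 1) • U i := by
    intro i hi
    rw [intervalIntegral.integral_smul_const, intervalIntegral.integral_div, (hoff i hi).2,
      smul_smul, smul_smul, ← sub_smul, meshMoment, meshMoment]
    congr 1
    ring
  rw [Finset.sum_congr rfl hterm, Finset.sum_sub_distrib, meshMoment, smul_smul,
    neg_div, neg_smul, div_eq_inv_mul]
  abel

end Integral

/-- The square of a step against the weight of the second derivative. -/
lemma sq_tmesh_step_mul_rpow_le {T γ β : ℝ} {N : ℕ} (hγ : 1 ≤ γ) (hβ : 2 / γ ≤ β) (hT : 0 < T)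
    (hN : 1 ≤ N) {i m : ℕ} (him : i ≤ m) :
    (tmesh T γ N (i + 1) - tmesh T γ N i) ^ 2 * tmesh T γ N (i + 1) ^ (β - 2) ≤
      γ ^ 2 * ((T ^ (1 / γ) / N) ^ 2 * tmesh T γ N (m + 1) ^ (β - 2 / γ)) := by
  set c := T ^ (1 / γ) / (N : ℝ) with hc
  set t := tmesh T γ N (i + 1) with ht
  have htp : 0 < t := tmesh_pos hT hN (by omega)
  have hr : t ^ (1 / γ) = (i + 1) * c := by
    have := tmesh_rpow (N := N) hγ hT (i + 1)
    push_cast at this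
    exact this
  have hi : (0:ℝ) < i + 1 := by positivity
  have hdiv : γ / ((i : ℝ) + 1) = γ * (c * t ^ (-(1 / γ))) := by
    have hcp : 0 < c := meshScale_pos hT hN
    rw [Real.rpow_neg htp.le, hr]
    field_simp
  have h1 : (t - tmesh T γ N i) ^ 2 ≤ (γ * (c * t ^ (-(1 / γ))) * t) ^ 2 := by
    rw [← hdiv]
    exact pow_le_pow_left₀ (sub_nonneg.2 (tmesh_mono hγ hT hN i.le_succ))
      (tmesh_step_le hγ hT i) 2
  have h2 : t ^ (β - 2 / γ) = (t ^ (-(1 / γ))) ^ 2 * t ^ 2 * t ^ (β - 2) := by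
    rw [← Real.rpow_natCast, ← Real.rpow_natCast, ← Real.rpow_mul htp.le, ← Real.rpow_add htp,
      ← Real.rpow_add htp]
    congr 1
    push_cast
    ring
  calc _ ≤ (γ * (c * t ^ (-(1 / γ))) * t) ^ 2 * t ^ (β - 2) :=
        mul_le_mul_of_nonneg_right h1 (by positivity)
    _ = γ ^ 2 * (c ^ 2 * t ^ (β - 2 / γ)) := by rw [h2]; ring
    _ ≤ _ := by
        gcongr
        exact tmesh_mono hγ hT hN (by omega)

lemma rpow_le_of_le_of_le_mul {s t r D : ℝ} (ht : 0 < t) (hD : 1 ≤ D) (hr : -3 ≤ r) (hst : s ≤ t)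
    (hts : t ≤ D * s) : s ^ r ≤ D ^ 3 * t ^ r := by
  have hs : 0 < s := by
    by_contra h
    nlinarith
  have hD3 : (1:ℝ) ≤ D ^ 3 := one_le_pow₀ hD
  rcases le_total 0 r with h | h
  · calc s ^ r ≤ t ^ r := Real.rpow_le_rpow hs.le hst h
      _ ≤ _ := le_mul_of_one_le_left (by positivity) hD3
  · have hD0 : 0 < D := by linarith
    have h1 : (D * s) ^ r ≤ t ^ r := Real.rpow_le_rpow_of_nonpos ht hts h
    have h2 : D ^ (-r) ≤ D ^ 3 := by
      rw [← Real.rpow_natCast]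
      exact Real.rpow_le_rpow_of_exponent_le hD (by push_cast; linarith)
    calc s ^ r = D ^ (-r) * (D * s) ^ r := by
          rw [Real.mul_rpow hD0.le hs.le, ← mul_assoc, ← Real.rpow_add hD0]; simp
      _ ≤ D ^ 3 * t ^ r := mul_le_mul h2 h1 (by positivity) (by positivity)

theorem stmt14 {X : Type*} [NormedAddCommGroup X] [NormedSpace ℝ X] [CompleteSpace X]
    (α M σ γ T : ℝ) (hα0 : 0 < α) (hα1 : α < 1) (hM : 0 < M) (hσ : 0 < σ)
    (hγ1 : 1 ≤ γ) (hγ : 2 / (σ + α/2) ≤ γ) (hT : 0 < T) :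
    ∃ C > 0, ∀ N : ℕ, 1 ≤ N →
      ∀ u u' u'' u''' : ℝ → X,
      (∀ s ∈ Set.Ioc (0:ℝ) T, HasDerivWithinAt u (u' s) (Set.Ioc (0:ℝ) T) s) →
      (∀ s ∈ Set.Ioc (0:ℝ) T, HasDerivWithinAt u' (u'' s) (Set.Ioc (0:ℝ) T) s) →
      (∀ s ∈ Set.Ioc (0:ℝ) T, HasDerivWithinAt u'' (u''' s) (Set.Ioc (0:ℝ) T) s) →
      ContinuousOn u''' (Set.Ioc (0:ℝ) T) →
      (∀ t ∈ Set.Ioc (0:ℝ) T, ‖u'' t‖ ≤ M * t ^ (σ + α/2 - 2)) →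
      (∀ t ∈ Set.Ioc (0:ℝ) T, ‖u''' t‖ ≤ M * t ^ (σ + α/2 - 3)) →
      ∀ e2 : ℝ → X,
      (∀ i : ℕ, 1 ≤ i → i ≤ N →
        ∀ s ∈ Set.Ioc (tmesh T γ N (i - 1)) (tmesh T γ N i),
          e2 s = (s - (tmesh T γ N (i - 1) + tmesh T γ N i) / 2) • u'' (tmesh T γ N i)) →
      ∀ j : ℕ, 1 ≤ j → j ≤ N →
        ‖∫ t in tmesh T γ N (j - 1)..tmesh T γ N j, Ifrac α e2 t‖ ≤
          C * (T ^ (1/γ) / (N : ℝ)) ^ 2 * tstep T γ N j *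
            (tmesh T γ N j) ^ (3*α/2 + σ - 1 - 2/γ) := by
  have hΓ : 0 < Real.Gamma α := Real.Gamma_pos_of_pos hα0
  have hdc : 0 < differenceConst γ α := by
    have := stretchConst_pos hγ1
    unfold differenceConst perturbConst
    positivity
  set β := σ + α / 2 with hβ
  have hβ0 : 0 < β := by positivity
  have hβγ : 2 / γ ≤ β := by
    rw [div_le_iff₀ hβ0] at hγ
    rw [div_le_iff₀ (by linarith)]
    linarith
  set D : ℝ := 2 ^ γ with hD
  have hD1 : 1 ≤ D := Real.one_le_rpow (by norm_num) (by linarith)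
  refine ⟨(Real.Gamma α)⁻¹ * (differenceConst γ α * (3 * M * D ^ 3 * γ ^ 3)), by positivity, ?_⟩
  intro N hN u u' u'' u''' _ _ hu2 _ hb2 hb3 e2 he j hj1 hjN
  obtain ⟨m, rfl⟩ : ∃ m, j = m + 1 := ⟨j - 1, by omega⟩
  rw [tstep, Nat.add_sub_cancel]
  set c := T ^ (1 / γ) / (N : ℝ) with hc
  have hcp : 0 < c := meshScale_pos hT hN
  set t := tmesh T γ N with ht
  have htm : ∀ {i j}, i ≤ j → t i ≤ t j := fun h => tmesh_mono hγ1 hT hN h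
  have htpos : ∀ i, 0 < t (i + 1) := fun i => tmesh_pos hT hN (by omega)
  have hmem : ∀ i ≤ m, t (i + 1) ∈ Set.Ioc 0 T := fun i hi =>
    ⟨htpos i, (htm (by omega : i + 1 ≤ N)).trans_eq (tmesh_last hγ1 hT hN)⟩
  set B := c ^ 2 * t (m + 1) ^ (β - 2 / γ) with hB
  have hBp : 0 < B := by have := htpos m; positivity
  have hconst : M * γ ^ 2 ≤ 3 * M * D ^ 3 * γ ^ 3 := by
    have h1 : (1:ℝ) ≤ D ^ 3 := one_le_pow₀ hD1
    have h2 : (1:ℝ) ≤ 3 * (D ^ 3 * γ) := by nlinarith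
    have h3 : 0 ≤ M * γ ^ 2 := by positivity
    nlinarith
  have hU : ∀ i ≤ m, (t (i + 1) - t i) ^ 2 * ‖u'' (t (i + 1))‖ ≤ 3 * M * D ^ 3 * γ ^ 3 * B := by
    intro i hi
    calc _ ≤ (t (i + 1) - t i) ^ 2 * (M * t (i + 1) ^ (β - 2)) :=
          mul_le_mul_of_nonneg_left (hb2 _ (hmem i hi)) (by positivity)
      _ = M * ((t (i + 1) - t i) ^ 2 * t (i + 1) ^ (β - 2)) := by ring
      _ ≤ M * (γ ^ 2 * B) :=
          mul_le_mul_of_nonneg_left (sq_tmesh_step_mul_rpow_le hγ1 hβγ hT hN hi) hM.le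
      _ = M * γ ^ 2 * B := by ring
      _ ≤ _ := mul_le_mul_of_nonneg_right hconst hBp.le
  have hdU : ∀ i, i + 1 ≤ m → m + 1 ≤ 3 * (i + 1) →
      (t (i + 2) - t (i + 1)) ^ 2 * ‖u'' (t (i + 2)) - u'' (t (i + 1))‖ ≤
        3 * M * D ^ 3 * γ ^ 3 * B / (m + 1) := by
    intro i him hi
    have htp : 0 < t (i + 2) := htpos (i + 1)
    have hle : t (i + 1) ≤ t (i + 2) := htm (by omega)
    have hhalf : t (i + 2) ≤ D * t (i + 1) := by
      refine tmesh_le_rpow_mul hγ1 hT (by norm_num) ?_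
      push_cast
      linarith [(Nat.cast_nonneg i : (0:ℝ) ≤ i)]
    have hsub : Set.Icc (t (i + 1)) (t (i + 2)) ⊆ Set.Ioc 0 T := fun s hs =>
      ⟨(htpos i).trans_le hs.1, hs.2.trans (hmem (i + 1) him).2⟩
    have hlip := Convex.norm_image_sub_le_of_norm_hasDerivWithin_le
      (C := M * (D ^ 3 * t (i + 2) ^ (β - 3)))
      (fun s hs => (hu2 s (hsub hs)).mono hsub)
      (fun s hs => (hb3 s (hsub hs)).trans (mul_le_mul_of_nonneg_left
        (rpow_le_of_le_of_le_mul htp hD1 (by linarith) hs.2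
          (hhalf.trans (mul_le_mul_of_nonneg_left hs.1 (by linarith)))) hM.le))
      (convex_Icc _ _) (Set.left_mem_Icc.2 hle) (Set.right_mem_Icc.2 hle)
    rw [Real.norm_of_nonneg (sub_nonneg.2 hle)] at hlip
    have hstep : t (i + 2) - t (i + 1) ≤ 3 * γ / (m + 1) * t (i + 2) := by
      refine (tmesh_step_le hγ1 hT (i + 1)).trans
        (mul_le_mul_of_nonneg_right ?_ htp.le)
      have hi' : (m : ℝ) + 1 ≤ 3 * (i + 1) := by exact_mod_cast hi
      rw [div_le_div_iff₀ (by positivity) (by positivity)]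
      push_cast
      nlinarith
    have hpow : t (i + 2) ^ (β - 2) = t (i + 2) ^ (β - 3) * t (i + 2) := by
      rw [← Real.rpow_add_one htp.ne']
      ring_nf
    have hsq := sq_tmesh_step_mul_rpow_le (N := N) hγ1 hβγ hT hN him
    calc _ ≤ (t (i + 2) - t (i + 1)) ^ 2 *
          (M * (D ^ 3 * t (i + 2) ^ (β - 3)) * (t (i + 2) - t (i + 1))) :=
          mul_le_mul_of_nonneg_left hlip (by positivity)
      _ ≤ (t (i + 2) - t (i + 1)) ^ 2 *
          (M * (D ^ 3 * t (i + 2) ^ (β - 3)) * (3 * γ / (m + 1) * t (i + 2))) := by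
          gcongr
      _ = 3 * M * D ^ 3 * γ / (m + 1) *
          ((t (i + 2) - t (i + 1)) ^ 2 * t (i + 2) ^ (β - 2)) := by rw [hpow]; ring
      _ ≤ 3 * M * D ^ 3 * γ / (m + 1) * (γ ^ 2 * B) :=
          mul_le_mul_of_nonneg_left hsq (by positivity)
      _ = _ := by ring
  have hmain := norm_sum_meshMoment_sub_le hα0 hα1 hγ1 hT hN (fun i => u'' (t (i + 1))) hU hdU
  rw [integral_Ifrac_eq (U := fun i => u'' (t (i + 1))) hα0 hγ1 hT hN
    fun i hi s hs => he (i + 1) (by omega) (by omega) s hs, norm_neg, norm_smul,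
    Real.norm_of_nonneg (inv_nonneg.2 hΓ.le)]
  have htp := htpos m
  have hpow : t (m + 1) ^ α = t (m + 1) ^ (α - 1) * t (m + 1) := by
    rw [← Real.rpow_add_one htp.ne']
    ring_nf
  have hexp : t (m + 1) ^ (3 * α / 2 + σ - 1 - 2 / γ)
      = t (m + 1) ^ (β - 2 / γ) * t (m + 1) ^ (α - 1) := by
    rw [← Real.rpow_add htp]
    congr 1
    rw [hβ]
    ring
  calc _ ≤ (Real.Gamma α)⁻¹ * (differenceConst γ α *
        (3 * M * D ^ 3 * γ ^ 3 * B / (m + 1) * t (m + 1) ^ α)) :=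
        mul_le_mul_of_nonneg_left hmain (inv_nonneg.2 hΓ.le)
    _ = (Real.Gamma α)⁻¹ * (differenceConst γ α * (3 * M * D ^ 3 * γ ^ 3)) * B *
        t (m + 1) ^ (α - 1) * (1 / ((m : ℝ) + 1) * t (m + 1)) := by rw [hpow]; ring
    _ ≤ (Real.Gamma α)⁻¹ * (differenceConst γ α * (3 * M * D ^ 3 * γ ^ 3)) * B *
        t (m + 1) ^ (α - 1) * (t (m + 1) - t m) :=
        mul_le_mul_of_nonneg_left (le_tmesh_step hγ1 hT m) (by positivity)
    _ = _ := by rw [hexp, hB]; ring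
end
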